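/- arXiv:1703.02820 — 3 statements merged into one kernel-verified Lean document; each statement's English description precedes it below -/
import Mathlib

section
/- The function f satisfies the functional equation f(x) − f(1 − x) = x − 1/2 for every ternary-irrational x ∈ (0,1). -/
/-- The `n`-th ternary digit of `x` (n = 0,1,2,...). -/
noncomputable def terDigit (n : ℕ) (x : ℝ) : ℤ := ⌊(3:ℝ)^(n+1) * x⌋ % 3

/-- φ(i) = (−3i² + 7i)/2, so φ(0)=0, φ(1)=2, φ(2)=1. -/
noncomputable def phi (i : ℤ) : ℝ := (-3*(i:ℝ)^2 + 7*(i:ℝ))/2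

/-- φ01(i) = (i² − i)/2. -/
noncomputable def phi01 (i : ℤ) : ℝ := ((i:ℝ)^2 - (i:ℝ))/2

/-- φ02(i) = −i² + 2i. -/
noncomputable def phi02 (i : ℤ) : ℝ := -(i:ℝ)^2 + 2*(i:ℝ)

/-- φ12(i) = (i² − 3i + 2)/2. -/
noncomputable def phi12 (i : ℤ) : ℝ := ((i:ℝ)^2 - 3*(i:ℝ) + 2)/2

/-- f(x) = ∑ φ(d_n(x))/3^(n+1). -/
noncomputable def f (x : ℝ) : ℝ := ∑' n : ℕ, phi (terDigit n x) / 3^(n+1)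

noncomputable def f01 (x : ℝ) : ℝ := ∑' n : ℕ, phi01 (terDigit n x) / 3^(n+1)

noncomputable def f02 (x : ℝ) : ℝ := ∑' n : ℕ, phi02 (terDigit n x) / 3^(n+1)

noncomputable def f12 (x : ℝ) : ℝ := ∑' n : ℕ, phi12 (terDigit n x) / 3^(n+1)

/-- `x` is ternary-irrational: `3^n x` is never an integer. -/
def TernaryIrrational (x : ℝ) : Prop := ∀ n : ℕ, ¬ ∃ k : ℤ, (3:ℝ)^n * x = (k:ℝ)

lemma terDigit_nonneg (n : ℕ) (x : ℝ) : 0 ≤ terDigit n x :=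
  Int.emod_nonneg _ (by norm_num)

lemma terDigit_lt_three (n : ℕ) (x : ℝ) : terDigit n x < 3 :=
  Int.emod_lt_of_pos _ (by norm_num)

lemma terDigit_eq_floor_sub (n : ℕ) (x : ℝ) :
    terDigit n x = ⌊(3:ℝ)^(n+1) * x⌋ - 3 * ⌊(3:ℝ)^n * x⌋ := by
  have h : ⌊(3:ℝ)^n * x⌋ = ⌊(3:ℝ)^(n+1) * x⌋ / 3 := by
    have h := Int.floor_div_natCast ((3:ℝ)^(n+1) * x) 3
    rw [show (3:ℝ)^(n+1) * x / (3:ℕ) = (3:ℝ)^n * x by push_cast; ring] at h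
    exact_mod_cast h
  rw [terDigit, h]
  lia

/-- The partial sums of the ternary expansion are the truncations of `x`. -/
lemma sum_range_terDigit {x : ℝ} (hx : x ∈ Set.Ioo (0:ℝ) 1) (n : ℕ) :
    ∑ k ∈ Finset.range n, (terDigit k x : ℝ) / 3^(k+1) = ⌊(3:ℝ)^n * x⌋ / (3:ℝ)^n := by
  induction n with
  | zero =>
    have h : ⌊x⌋ = 0 := Int.floor_eq_zero_iff.2 ⟨hx.1.le, hx.2⟩
    simp [h]
  | succ n ih =>
    rw [Finset.sum_range_succ, ih, terDigit_eq_floor_sub]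
    push_cast
    field_simp
    ring

lemma hasSum_terDigit {x : ℝ} (hx : x ∈ Set.Ioo (0:ℝ) 1) :
    HasSum (fun n ↦ (terDigit n x : ℝ) / 3^(n+1)) x := by
  have hnonneg (n : ℕ) : 0 ≤ (terDigit n x : ℝ) / 3^(n+1) :=
    div_nonneg (by exact_mod_cast terDigit_nonneg n x) (by positivity)
  rw [hasSum_iff_tendsto_nat_of_nonneg hnonneg]
  simp_rw [sum_range_terDigit hx]
  have hpow : Filter.Tendsto (fun n : ℕ ↦ x - (1/3:ℝ)^n) Filter.atTop (nhds x) := by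
    simpa using tendsto_const_nhds.sub
      (tendsto_pow_atTop_nhds_zero_of_lt_one (r := (1/3:ℝ)) (by norm_num) (by norm_num))
  refine tendsto_of_tendsto_of_tendsto_of_le_of_le hpow tendsto_const_nhds
    (fun n ↦ ?_) (fun n ↦ ?_)
  · have h := Int.lt_floor_add_one ((3:ℝ)^n * x)
    have h3 : (0:ℝ) < 3^n := by positivity
    simp only [one_div, inv_pow]
    rw [le_div_iff₀ h3, sub_mul, inv_mul_cancel₀ h3.ne']
    linarith
  · have h := Int.floor_le ((3:ℝ)^n * x)
    have h3 : (0:ℝ) < 3^n := by positivity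
    simp only
    rw [div_le_iff₀ h3]
    linarith

lemma summable_phi_terDigit (x : ℝ) : Summable (fun n ↦ phi (terDigit n x) / 3^(n+1)) := by
  have hgeom : Summable (fun n : ℕ ↦ 2/3 * (1/3:ℝ)^n) :=
    (summable_geometric_of_lt_one (by norm_num) (by norm_num)).mul_left _
  have hphi (n : ℕ) : 0 ≤ phi (terDigit n x) ∧ phi (terDigit n x) ≤ 2 := by
    have h0 := terDigit_nonneg n x
    have h3 := terDigit_lt_three n x
    generalize terDigit n x = d at *
    interval_cases d <;> norm_num [phi]
  refine hgeom.of_nonneg_of_le (fun n ↦ div_nonneg (hphi n).1 (by positivity)) (fun n ↦ ?_)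
  calc phi (terDigit n x) / 3^(n+1) ≤ 2 / 3^(n+1) := by gcongr; exact (hphi n).2
    _ = 2/3 * (1/3:ℝ)^n := by rw [one_div, inv_pow]; field_simp; ring

/-- Reflecting a ternary-irrational number about `1/2` exchanges the digits `0` and `2`. -/
lemma TernaryIrrational.terDigit_one_sub {x : ℝ} (hx : TernaryIrrational x) (n : ℕ) :
    terDigit n (1 - x) = 2 - terDigit n x := by
  have hfloor (m : ℕ) : ⌊(3:ℝ)^m * (1 - x)⌋ = 3^m - 1 - ⌊(3:ℝ)^m * x⌋ := by
    have hle := Int.floor_le ((3:ℝ)^m * x)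
    have hlt := Int.lt_floor_add_one ((3:ℝ)^m * x)
    have hne : (⌊(3:ℝ)^m * x⌋ : ℝ) ≠ (3:ℝ)^m * x := fun h ↦ hx m ⟨_, h.symm⟩
    have hlt' := lt_of_le_of_ne hle hne
    rw [Int.floor_eq_iff]
    push_cast
    constructor <;> linarith
  rw [terDigit_eq_floor_sub, terDigit_eq_floor_sub, hfloor, hfloor]
  ring

lemma phi_sub_phi_two_sub (d : ℤ) : phi d - phi (2 - d) = d - 1 := by
  simp only [phi]
  push_cast
  ring

theorem stmt_12 : ∀ x ∈ Set.Ioo (0:ℝ) 1, TernaryIrrational x →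
    f x - f (1 - x) = x - 1/2 := by
  intro x hx hirr
  have hhalf : HasSum (fun n : ℕ ↦ (1:ℝ) / 3^(n+1)) (1/2) := by
    have hterm : (fun n : ℕ ↦ (1:ℝ) / 3^(n+1)) = fun n ↦ 1/3 * (1/3:ℝ)^n := by
      ext n
      rw [pow_succ, one_div_pow]
      field_simp
    rw [hterm, show (1/2:ℝ) = 1/3 * (1 - 1/3)⁻¹ by norm_num]
    exact (hasSum_geometric_of_lt_one (by norm_num) (by norm_num)).mul_left (1/3)
  have hdiff := (summable_phi_terDigit x).hasSum.sub (summable_phi_terDigit (1 - x)).hasSum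
  refine hdiff.unique ?_
  convert (hasSum_terDigit hx).sub hhalf using 2 with n
  rw [hirr.terDigit_one_sub, ← sub_div, phi_sub_phi_two_sub, sub_div]
end

section
/- If y ∈ [0,1) has at least one digit 2 in its ternary representation (i.e. d_n(y) = 2 for some n), then y has no preimage under any of the functions f01, f02, f12: for every x ∈ [0,1), f01(x) ≠ y, f02(x) ≠ y and f12(x) ≠ y. -/
lemma summable_div_three_pow {a : ℕ → ℝ} (ha : ∀ n, a n = 0 ∨ a n = 1) :
    Summable fun n ↦ a n / 3 ^ (n + 1) := by
  refine Summable.of_nonneg_of_le (fun n ↦ ?_) (fun n ↦ ?_)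
    (summable_geometric_of_lt_one (r := (1 / 3 : ℝ)) (by norm_num) (by norm_num))
  · rcases ha n with h | h <;> rw [h] <;> positivity
  · rw [one_div_pow]
    have h1 : a n ≤ 1 := by rcases ha n with h | h <;> rw [h] <;> norm_num
    gcongr
    · norm_num
    · omega

lemma tsum_div_three_pow_mem_Ico {a : ℕ → ℝ} (ha : ∀ n, a n = 0 ∨ a n = 1) :
    ∑' n, a n / 3 ^ (n + 1) ∈ Set.Ico (0 : ℝ) 1 := by
  constructor
  · refine tsum_nonneg fun n ↦ ?_
    rcases ha n with h | h <;> rw [h] <;> positivity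
  · have hg : HasSum (fun n : ℕ ↦ (1 / 3 : ℝ) * (1 / 3) ^ n) (1 / 2) := by
      have h := (hasSum_geometric_of_lt_one (r := (1 / 3 : ℝ))
        (by norm_num) (by norm_num)).mul_left (1 / 3)
      rwa [show (1 / 3 : ℝ) * (1 - 1 / 3)⁻¹ = 1 / 2 by norm_num] at h
    have hle : ∑' n, a n / 3 ^ (n + 1) ≤ 1 / 2 := by
      rw [← hg.tsum_eq]
      refine (summable_div_three_pow ha).tsum_le_tsum (fun n ↦ ?_) hg.summable
      rw [← pow_succ', one_div_pow]
      have h1 : a n ≤ 1 := by rcases ha n with h | h <;> rw [h] <;> norm_num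
      gcongr
    linarith

lemma three_mul_tsum_div_three_pow {a : ℕ → ℝ} (ha : ∀ n, a n = 0 ∨ a n = 1) :
    3 * ∑' n, a n / 3 ^ (n + 1) = a 0 + ∑' n, a (n + 1) / 3 ^ (n + 1) := by
  rw [(summable_div_three_pow ha).tsum_eq_zero_add, mul_add, ← tsum_mul_left]
  congr 1
  · ring
  · refine tsum_congr fun n ↦ ?_
    field_simp
    ring

lemma exists_int_three_pow_mul_tsum {a : ℕ → ℝ} (ha : ∀ n, a n = 0 ∨ a n = 1) (m : ℕ) :
    ∃ k : ℤ, 3 ^ m * ∑' n, a n / 3 ^ (n + 1) = k + ∑' n, a (n + m) / 3 ^ (n + 1) := by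
  induction m with
  | zero => exact ⟨0, by simp⟩
  | succ m ih =>
    obtain ⟨k, hk⟩ := ih
    have hs := three_mul_tsum_div_three_pow (a := fun n ↦ a (n + m)) fun n ↦ ha _
    simp only [zero_add, add_right_comm _ 1 m] at hs
    simp only [← add_assoc]
    rcases ha m with h | h
    · refine ⟨3 * k, ?_⟩
      push_cast
      linear_combination 3 * hk + hs + h
    · refine ⟨3 * k + 1, ?_⟩
      push_cast
      linear_combination 3 * hk + hs + h

/-- A ternary expansion with all digits in `{0, 1}` has no digit `2`. -/
lemma terDigit_tsum_ne_two {a : ℕ → ℝ} (ha : ∀ n, a n = 0 ∨ a n = 1) (m : ℕ) :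
    terDigit m (∑' n, a n / 3 ^ (n + 1)) ≠ 2 := by
  obtain ⟨k, hk⟩ := exists_int_three_pow_mul_tsum ha m
  have hs := three_mul_tsum_div_three_pow (a := fun n ↦ a (n + m)) fun n ↦ ha _
  obtain ⟨h0, h1⟩ := tsum_div_three_pow_mem_Ico (a := fun n ↦ a (n + 1 + m)) fun n ↦ ha _
  simp only [zero_add] at hs
  unfold terDigit
  rcases ha m with h | h
  · have hf : ⌊(3 : ℝ) ^ (m + 1) * ∑' n, a n / 3 ^ (n + 1)⌋ = 3 * k := by
      rw [pow_succ', mul_assoc, hk, Int.floor_eq_iff]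
      push_cast
      constructor <;> linarith
    omega
  · have hf : ⌊(3 : ℝ) ^ (m + 1) * ∑' n, a n / 3 ^ (n + 1)⌋ = 3 * k + 1 := by
      rw [pow_succ', mul_assoc, hk, Int.floor_eq_iff]
      push_cast
      constructor <;> linarith
    omega

lemma terDigit_eq_zero_or_one_or_two (n : ℕ) (x : ℝ) :
    terDigit n x = 0 ∨ terDigit n x = 1 ∨ terDigit n x = 2 := by
  unfold terDigit
  omega

theorem stmt_16 (y : ℝ) (hy : y ∈ Set.Ico (0:ℝ) 1) (h2 : ∃ n : ℕ, terDigit n y = 2) :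
    ∀ x ∈ Set.Ico (0:ℝ) 1, f01 x ≠ y ∧ f02 x ≠ y ∧ f12 x ≠ y := by
  obtain ⟨m, hm⟩ := h2
  intro x _
  refine ⟨?_, ?_, ?_⟩ <;> rintro rfl <;> refine terDigit_tsum_ne_two (fun n ↦ ?_) m hm <;>
    rcases terDigit_eq_zero_or_one_or_two n x with h | h | h <;> rw [h] <;>
    norm_num [phi01, phi02, phi12]
end

section
/- The level set of 0 of each of the functions f01, f02, f12 has Hausdorff dimension log 2 / log 3: dimH {x ∈ [0,1) : f01(x) = 0} = dimH {x ∈ [0,1) : f02(x) = 0} = dimH {x ∈ [0,1) : f12(x) = 0} = log 2 / log 3. Moreover, for every y ∈ [0,1), dimH {x ∈ [0,1) : f01(x) = y} ≤ log 2 / log 3. -/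
/-- A signed ternary series whose first nonzero coefficient is a unit at position `n`
is bounded away from zero by half of `3⁻⁽ⁿ⁺¹⁾`. -/
lemma le_abs_tsum_div_three_pow {u : ℕ → ℝ} {n : ℕ} (hle : ∀ i, |u i| ≤ 1)
    (hzero : ∀ i < n, u i = 0) (hn : |u n| = 1) :
    ((3 : ℝ) ^ (n + 1))⁻¹ / 2 ≤ |∑' i, u i / 3 ^ (i + 1)| := by
  have hbound : ∀ i, ‖u i / 3 ^ (i + 1)‖ ≤ (1 / 3 : ℝ) ^ (i + 1) := fun i ↦ by
    rw [Real.norm_eq_abs, abs_div, abs_of_pos (by positivity : (0 : ℝ) < 3 ^ (i + 1)), div_pow,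
      one_pow]
    gcongr
    exact hle i
  have hgeom : HasSum (fun i ↦ (1 / 3 : ℝ) ^ (i + (n + 1) + 1)) (((3 : ℝ) ^ (n + 1))⁻¹ / 2) := by
    have h := (hasSum_geometric_of_lt_one (r := (1 / 3 : ℝ)) (by norm_num)
      (by norm_num)).mul_left ((1 / 3 : ℝ) ^ (n + 2))
    have hterm : (fun i ↦ (1 / 3 : ℝ) ^ (i + (n + 1) + 1)) =
        fun i ↦ (1 / 3 : ℝ) ^ (n + 2) * (1 / 3) ^ i := by
      funext i
      ring
    have hval : ((3 : ℝ) ^ (n + 1))⁻¹ / 2 = (1 / 3 : ℝ) ^ (n + 2) * (1 - 1 / 3)⁻¹ := by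
      rw [div_pow, one_pow, pow_succ _ (n + 1)]
      field_simp
      norm_num
    rw [hterm, hval]
    exact h
  have hsum : Summable fun i ↦ u i / 3 ^ (i + 1) :=
    Summable.of_norm_bounded ((summable_nat_add_iff 1).2
      (summable_geometric_of_lt_one (by norm_num) (by norm_num))) hbound
  have htail : |∑' i, u (i + (n + 1)) / 3 ^ (i + (n + 1) + 1)| ≤ ((3 : ℝ) ^ (n + 1))⁻¹ / 2 :=
    tsum_of_norm_bounded hgeom fun i ↦ hbound _
  have hhead : |u n / 3 ^ (n + 1)| = ((3 : ℝ) ^ (n + 1))⁻¹ := by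
    rw [abs_div, hn, abs_of_pos (by positivity : (0 : ℝ) < 3 ^ (n + 1)), one_div]
  rw [← hsum.sum_add_tsum_nat_add (n + 1), Finset.sum_range_succ,
    Finset.sum_eq_zero fun i hi ↦ by rw [hzero i (Finset.mem_range.1 hi), zero_div], zero_add]
  have h := abs_sub_abs_le_abs_sub (u n / 3 ^ (n + 1))
    (-∑' i, u (i + (n + 1)) / 3 ^ (i + (n + 1) + 1))
  rw [sub_neg_eq_add, abs_neg] at h
  linarith

lemma terDigit_mem (n : ℕ) (x : ℝ) : terDigit n x ∈ ({0, 1, 2} : Finset ℤ) := by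
  simp only [terDigit, Finset.mem_insert, Finset.mem_singleton]
  omega

lemma floor_three_pow_succ (n : ℕ) (x : ℝ) :
    ⌊(3 : ℝ) ^ (n + 1) * x⌋ = 3 * ⌊(3 : ℝ) ^ n * x⌋ + terDigit n x := by
  have h : ⌊(3 : ℝ) ^ n * x⌋ = ⌊(3 : ℝ) ^ (n + 1) * x⌋ / 3 := by
    have h1 := Int.floor_le ((3 : ℝ) ^ (n + 1) * x)
    have h2 := Int.lt_floor_add_one ((3 : ℝ) ^ (n + 1) * x)
    set m := ⌊(3 : ℝ) ^ (n + 1) * x⌋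
    rw [pow_succ] at h1 h2
    rw [Int.floor_eq_iff]
    have h3 : ((3 * (m / 3) : ℤ) : ℝ) ≤ m := by exact_mod_cast (by omega)
    have h4 : ((m + 1 : ℤ) : ℝ) ≤ ((3 * (m / 3) + 3 : ℤ) : ℝ) := by exact_mod_cast (by omega)
    push_cast at h3 h4
    constructor <;> linarith
  rw [h, terDigit]
  omega

lemma abs_sub_le_of_terDigit_eq {x y : ℝ} (hx : x ∈ Set.Ico (0 : ℝ) 1)
    (hy : y ∈ Set.Ico (0 : ℝ) 1) {n : ℕ} (h : ∀ i < n, terDigit i x = terDigit i y) :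
    |x - y| ≤ ((3 : ℝ) ^ n)⁻¹ := by
  have hfloor : ∀ k ≤ n, ⌊(3 : ℝ) ^ k * x⌋ = ⌊(3 : ℝ) ^ k * y⌋ := by
    intro k
    induction k with
    | zero =>
      intro _
      simp [Int.floor_eq_zero_iff.2 hx, Int.floor_eq_zero_iff.2 hy]
    | succ k ih =>
      intro hk
      rw [floor_three_pow_succ, floor_three_pow_succ, ih (by omega), h k (by omega)]
  have hlt := Int.abs_sub_lt_one_of_floor_eq_floor (hfloor n le_rfl)
  rw [← mul_sub, abs_mul, abs_of_pos (by positivity : (0 : ℝ) < 3 ^ n)] at hlt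
  rw [← one_div, le_div_iff₀ (by positivity)]
  linarith

lemma three_rpow_log_two_div_log_three : (3 : ℝ) ^ (Real.log 2 / Real.log 3) = 2 := by
  have h3 : Real.log 3 ≠ 0 := (Real.log_pos (by norm_num)).ne'
  rw [Real.rpow_def_of_pos (by norm_num), mul_div_cancel₀ _ h3, Real.exp_log (by norm_num)]

lemma log_two_div_log_three_pos : 0 < Real.log 2 / Real.log 3 :=
  div_pos (Real.log_pos (by norm_num)) (Real.log_pos (by norm_num))

lemma inv_three_pow_rpow (n : ℕ) :
    (((3 : ℝ) ^ n)⁻¹) ^ (Real.log 2 / Real.log 3) = ((2 : ℝ) ^ n)⁻¹ := by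
  rw [Real.inv_rpow (by positivity), ← Real.rpow_natCast 3 n, ← Real.rpow_mul (by norm_num),
    mul_comm, Real.rpow_mul (by norm_num), three_rpow_log_two_div_log_three, Real.rpow_natCast]

/-- A set whose points have at most two possible ternary digits at each position has Hausdorff
dimension at most `log 2 / log 3`. -/
lemma dimH_le_of_terDigit_mem {S : Set ℝ} (hS : S ⊆ Set.Ico (0 : ℝ) 1) (A : ℕ → Finset ℤ)
    (hA : ∀ n, (A n).card ≤ 2) (hmem : ∀ x ∈ S, ∀ n, terDigit n x ∈ A n) :
    dimH S ≤ ENNReal.ofReal (Real.log 2 / Real.log 3) := by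
  set s := Real.log 2 / Real.log 3
  let t : ∀ n : ℕ, ((i : Fin n) → A i) → Set ℝ := fun n g ↦
    {x | x ∈ Set.Ico (0 : ℝ) 1 ∧ ∀ i : Fin n, terDigit i x = g i}
  have hdiam : ∀ n g, Metric.ediam (t n g) ≤ ENNReal.ofReal ((3 : ℝ) ^ n)⁻¹ := fun n g ↦ by
    refine Metric.ediam_le fun x hx y hy ↦ ?_
    rw [edist_dist, Real.dist_eq]
    exact ENNReal.ofReal_le_ofReal (abs_sub_le_of_terDigit_eq hx.1 hy.1 fun i hi ↦
      (hx.2 ⟨i, hi⟩).trans (hy.2 ⟨i, hi⟩).symm)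
  have hlim : Filter.Tendsto (fun n : ℕ ↦ ENNReal.ofReal ((3 : ℝ) ^ n)⁻¹) Filter.atTop
      (nhds 0) := by
    rw [← ENNReal.ofReal_zero]
    refine ENNReal.tendsto_ofReal ?_
    simp_rw [← inv_pow]
    exact tendsto_pow_atTop_nhds_zero_of_lt_one (by norm_num) (by norm_num)
  have hcover : ∀ n, S ⊆ ⋃ g, t n g := fun n x hx ↦
    Set.mem_iUnion.2 ⟨fun i ↦ ⟨terDigit i x, hmem x hx i⟩, hS hx, fun _ ↦ rfl⟩
  have hcount : ∀ n, ∑ g, Metric.ediam (t n g) ^ s ≤ 1 := fun n ↦ by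
    have hcard : Fintype.card ((i : Fin n) → A i) ≤ 2 ^ n := by
      rw [Fintype.card_pi]
      refine (Finset.prod_le_pow_card _ _ 2 fun i _ ↦ ?_).trans (by simp)
      simpa using hA i
    calc ∑ g, Metric.ediam (t n g) ^ s
        ≤ ∑ _g : (i : Fin n) → A i, ENNReal.ofReal ((2 : ℝ) ^ n)⁻¹ := by
          refine Finset.sum_le_sum fun g _ ↦ ?_
          rw [← inv_three_pow_rpow, ← ENNReal.ofReal_rpow_of_nonneg (by positivity)
            log_two_div_log_three_pos.le]
          exact ENNReal.rpow_le_rpow (hdiam n g) log_two_div_log_three_pos.le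
      _ = Fintype.card ((i : Fin n) → A i) * ENNReal.ofReal ((2 : ℝ) ^ n)⁻¹ := by
          rw [Finset.sum_const, nsmul_eq_mul, Finset.card_univ]
      _ ≤ ENNReal.ofReal ((2 : ℝ) ^ n) * ENNReal.ofReal ((2 : ℝ) ^ n)⁻¹ := by
          gcongr
          rw [← ENNReal.ofReal_natCast]
          exact ENNReal.ofReal_le_ofReal (by exact_mod_cast hcard)
      _ = 1 := by
          rw [← ENNReal.ofReal_mul (by positivity), mul_inv_cancel₀ (by positivity),
            ENNReal.ofReal_one]
  refine dimH_le_of_hausdorffMeasure_ne_top (d := s.toNNReal) (ne_top_of_le_ne_top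
    ENNReal.one_ne_top ?_)
  rw [Real.coe_toNNReal _ log_two_div_log_three_pos.le]
  refine (MeasureTheory.Measure.hausdorffMeasure_le_liminf_sum s S _ hlim t
    (Filter.Eventually.of_forall hdiam) (Filter.Eventually.of_forall hcover)).trans ?_
  refine (Filter.liminf_le_liminf (Filter.Eventually.of_forall hcount)).trans ?_
  rw [Filter.liminf_const]

/-- Level sets of a ternary series whose coefficient function takes both values `0` and `1`
on digits have Hausdorff dimension at most `log 2 / log 3`. -/
lemma dimH_level_le {φ : ℤ → ℝ} (hφ : ∀ d ∈ ({0, 1, 2} : Finset ℤ), φ d = 0 ∨ φ d = 1)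
    (hne : ∀ v, ∃ d ∈ ({0, 1, 2} : Finset ℤ), φ d ≠ v) (y : ℝ) :
    dimH {x ∈ Set.Ico (0 : ℝ) 1 | ∑' n : ℕ, φ (terDigit n x) / 3 ^ (n + 1) = y} ≤
      ENNReal.ofReal (Real.log 2 / Real.log 3) := by
  classical
  rcases Set.eq_empty_or_nonempty
    {x ∈ Set.Ico (0 : ℝ) 1 | ∑' n : ℕ, φ (terDigit n x) / 3 ^ (n + 1) = y} with h | ⟨x₀, -, h₀⟩
  · rw [h, dimH_empty]
    exact zero_le
  have hsum : ∀ x, Summable fun n ↦ φ (terDigit n x) / 3 ^ (n + 1) := fun x ↦ by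
    refine Summable.of_nonneg_of_le (f := fun n ↦ (1 / 3 : ℝ) ^ (n + 1)) (fun n ↦ ?_) (fun n ↦ ?_)
      ((summable_nat_add_iff 1).2 (summable_geometric_of_lt_one (by norm_num) (by norm_num)))
    · rcases hφ _ (terDigit_mem n x) with h | h <;> rw [h] <;> positivity
    · rw [div_pow, one_pow]
      gcongr
      rcases hφ _ (terDigit_mem n x) with h | h <;> rw [h]
      exact zero_le_one
  refine dimH_le_of_terDigit_mem (fun x hx ↦ hx.1)
    (fun n ↦ ({0, 1, 2} : Finset ℤ).filter fun d ↦ φ d = φ (terDigit n x₀)) (fun n ↦ ?_) ?_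
  · have := Finset.card_lt_card (Finset.filter_ssubset.2 (hne (φ (terDigit n x₀))))
    exact Nat.le_of_lt_succ this
  rintro x ⟨-, hx⟩ n
  refine Finset.mem_filter.2 ⟨terDigit_mem n x, ?_⟩
  induction n using Nat.strong_induction_on with
  | _ n ih =>
    by_contra hcon
    have hgap := le_abs_tsum_div_three_pow
      (u := fun i ↦ φ (terDigit i x) - φ (terDigit i x₀)) (n := n) (fun i ↦ ?_)
      (fun i hi ↦ sub_eq_zero.2 (ih i hi)) ?_
    · simp_rw [sub_div] at hgap
      rw [(hsum x).tsum_sub (hsum x₀), hx, h₀, sub_self, abs_zero] at hgap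
      exact absurd hgap (not_le.2 (by positivity))
    · rcases hφ _ (terDigit_mem i x) with h | h <;>
        rcases hφ _ (terDigit_mem i x₀) with k | k <;> simp [h, k]
    · rcases hφ _ (terDigit_mem n x) with h | h <;>
        rcases hφ _ (terDigit_mem n x₀) with k | k <;> simp [h, k] at hcon ⊢

lemma ofDigits_lt_one {d : ℕ → Fin 3} {m : ℕ} (hm : d m ≠ 2) : Real.ofDigits d < 1 := by
  rw [← Real.ofDigits_const_last_eq_one 2]
  refine Summable.tsum_lt_tsum (i := m) (fun n ↦ ?_) ?_ Real.summable_ofDigitsTerm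
    Real.summable_ofDigitsTerm
  · simp only [Real.ofDigitsTerm]
    gcongr
    exact Fin.le_last _
  · simp only [Real.ofDigitsTerm]
    gcongr
    exact Fin.val_fin_lt.2 (lt_of_le_of_ne (Fin.le_last _) hm)

lemma terDigit_ofDigits {d : ℕ → Fin 3} (hd : ∀ n, ∃ m, d (m + n) ≠ 2) (n : ℕ) :
    terDigit n (Real.ofDigits d) = ((d n : ℕ) : ℤ) := by
  have hint : ∀ k, ∃ N : ℤ,
      (3 : ℝ) ^ k * ∑ i ∈ Finset.range k, Real.ofDigitsTerm d i = N := fun k ↦ by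
    induction k with
    | zero => exact ⟨0, by simp⟩
    | succ k ih =>
      obtain ⟨N, hN⟩ := ih
      refine ⟨3 * N + (d k : ℕ), ?_⟩
      rw [Finset.sum_range_succ, mul_add, pow_succ', mul_assoc, hN, ← pow_succ',
        Real.ofDigitsTerm]
      push_cast
      field_simp
  obtain ⟨N, hN⟩ := hint n
  obtain ⟨m, hm⟩ := hd (n + 1)
  have hfloor : ⌊(3 : ℝ) ^ (n + 1) * Real.ofDigits d⌋ = 3 * N + (d n : ℕ) := by
    have h0 := Real.ofDigits_nonneg fun i ↦ d (i + (n + 1))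
    have h1 := ofDigits_lt_one (d := fun i ↦ d (i + (n + 1))) hm
    have heq : (3 : ℝ) ^ (n + 1) * Real.ofDigits d =
        3 * N + (d n : ℕ) + Real.ofDigits fun i ↦ d (i + (n + 1)) := by
      rw [Real.ofDigits_eq_sum_add_ofDigits d (n + 1), Finset.sum_range_succ, ← hN,
        Real.ofDigitsTerm]
      push_cast
      field_simp
      ring
    rw [Int.floor_eq_iff, heq]
    push_cast
    constructor <;> linarith
  rw [terDigit, hfloor]
  have := (d n).isLt
  omega

/-- Binary digit sequences of points of `[0, 1)` are not eventually `1`. -/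
lemma exists_digits_two_eq_zero {y : ℝ} (hy : y ∈ Set.Ico (0 : ℝ) 1) (n : ℕ) :
    ∃ m, Real.digits y 2 (m + n) = 0 := by
  by_contra! h
  have htail : (fun i ↦ Real.digits y 2 (i + n)) = fun _ ↦ Fin.last 1 := by
    funext i
    have := h i
    generalize Real.digits y 2 (i + n) = e at *
    revert e
    decide
  have hsplit := Real.ofDigits_eq_sum_add_ofDigits (Real.digits y 2) n
  have hlast : Real.ofDigits (fun _ : ℕ ↦ Fin.last 1) = 1 := Real.ofDigits_const_last_eq_one 1
  rw [Real.ofDigits_digits one_lt_two hy, htail, hlast] at hsplit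
  have hfloor := Real.ofDigits_digits_sum_eq (b := 2) hy n
  have hlt := Nat.lt_floor_add_one (((2 : ℕ) : ℝ) ^ n * y)
  rw [← hfloor] at hlt
  have : ((2 : ℕ) : ℝ) ^ n * y = ((2 : ℕ) : ℝ) ^ n *
      ∑ i ∈ Finset.range n, Real.ofDigitsTerm (Real.digits y 2) i + 1 := by
    conv_lhs => rw [hsplit]
    push_cast
    field_simp
  linarith

lemma abs_fin_two_sub_le (s t : Fin 2) : |((s : ℕ) : ℝ) - (t : ℕ)| ≤ 1 := by
  fin_cases s <;> fin_cases t <;> simp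

lemma abs_fin_two_sub_eq {s t : Fin 2} (h : s ≠ t) : |((s : ℕ) : ℝ) - (t : ℕ)| = 1 := by
  fin_cases s <;> fin_cases t <;> simp at h ⊢

lemma le_abs_ofDigits_comp_sub {σ : Fin 2 → Fin 3} {p q : ℝ} (hq : 1 ≤ q)
    (hσ : ∀ t, ((σ t : ℕ) : ℝ) = p + q * (t : ℕ)) {a b : ℕ → Fin 2} {n : ℕ}
    (hlt : ∀ i < n, a i = b i) (hn : a n ≠ b n) :
    ((3 : ℝ) ^ (n + 1))⁻¹ / 2 ≤ |Real.ofDigits (σ ∘ a) - Real.ofDigits (σ ∘ b)| := by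
  have hgap := le_abs_tsum_div_three_pow (u := fun i ↦ ((a i : ℕ) : ℝ) - (b i : ℕ))
    (fun i ↦ abs_fin_two_sub_le _ _) (fun i hi ↦ by rw [hlt i hi, sub_self])
    (abs_fin_two_sub_eq hn)
  have heq : Real.ofDigits (σ ∘ a) - Real.ofDigits (σ ∘ b) =
      q * ∑' i, (((a i : ℕ) : ℝ) - (b i : ℕ)) / 3 ^ (i + 1) := by
    rw [Real.ofDigits, Real.ofDigits,
      ← Real.summable_ofDigitsTerm.tsum_sub Real.summable_ofDigitsTerm, ← tsum_mul_left]
    refine tsum_congr fun i ↦ ?_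
    simp only [Real.ofDigitsTerm, Function.comp_apply, hσ]
    push_cast
    ring
  rw [heq, abs_mul, abs_of_pos (by linarith)]
  nlinarith [abs_nonneg (∑' i, (((a i : ℕ) : ℝ) - (b i : ℕ)) / 3 ^ (i + 1))]

lemma abs_ofDigits_sub_le_rpow {σ : Fin 2 → Fin 3} {p q : ℝ} (hq : 1 ≤ q)
    (hσ : ∀ t, ((σ t : ℕ) : ℝ) = p + q * (t : ℕ)) (a b : ℕ → Fin 2) :
    |Real.ofDigits a - Real.ofDigits b| ≤ 2 * 2 ^ (Real.log 2 / Real.log 3) *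
      |Real.ofDigits (σ ∘ a) - Real.ofDigits (σ ∘ b)| ^ (Real.log 2 / Real.log 3) := by
  classical
  by_cases hab : a = b
  · subst hab
    simp only [sub_self, abs_zero]
    positivity
  have hex : ∃ n, a n ≠ b n := Function.ne_iff.1 hab
  set n := Nat.find hex
  have hlt : ∀ i < n, a i = b i := fun i hi ↦ not_not.1 (Nat.find_min hex hi)
  have hgap := le_abs_ofDigits_comp_sub hq hσ hlt (Nat.find_spec hex)
  have hpow := Real.rpow_le_rpow (by positivity)
    ((div_le_iff₀' two_pos).1 hgap) log_two_div_log_three_pos.le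
  rw [inv_three_pow_rpow, Real.mul_rpow two_pos.le (abs_nonneg _)] at hpow
  have hup := Real.abs_ofDigits_sub_ofDigits_le hlt
  have htwo : (((2 : ℕ) : ℝ) ^ n)⁻¹ = 2 * ((2 : ℝ) ^ (n + 1))⁻¹ := by
    rw [pow_succ]
    push_cast
    field_simp
  rw [htwo] at hup
  linarith

/-- A set containing all ternary expansions with two prescribed digits has Hausdorff dimension
at least `log 2 / log 3`. -/
lemma le_dimH_of_ofDigits_comp_mem {σ : Fin 2 → Fin 3} {p q : ℝ} (hq : 1 ≤ q)
    (hσ : ∀ t, ((σ t : ℕ) : ℝ) = p + q * (t : ℕ)) {L : Set ℝ}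
    (hL : ∀ a : ℕ → Fin 2, (∀ n, ∃ m, a (m + n) = 0) → Real.ofDigits (σ ∘ a) ∈ L) :
    ENNReal.ofReal (Real.log 2 / Real.log 3) ≤ dimH L := by
  set s := Real.log 2 / Real.log 3
  have hspos : 0 < s := log_two_div_log_three_pos
  let K : Set (ℕ → Fin 2) := {a | ∀ n, ∃ m, a (m + n) = 0}
  let X : (ℕ → Fin 2) → ℝ := fun a ↦ Real.ofDigits (σ ∘ a)
  let g : ℝ → ℝ := fun x ↦ Real.ofDigits (Function.invFunOn X K x)
  have hX : Function.Injective X := fun a b hab ↦ by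
    by_contra hne
    have hex : ∃ n, a n ≠ b n := Function.ne_iff.1 hne
    classical
    have hgap := le_abs_ofDigits_comp_sub hq hσ
      (fun i hi ↦ not_not.1 (Nat.find_min hex hi)) (Nat.find_spec hex)
    rw [show Real.ofDigits (σ ∘ a) = Real.ofDigits (σ ∘ b) from hab, sub_self, abs_zero] at hgap
    exact absurd hgap (not_le.2 (by positivity))
  have hg : ∀ a ∈ K, g (X a) = Real.ofDigits a := fun a ha ↦
    congrArg Real.ofDigits (hX (Function.invFunOn_eq ⟨a, ha, rfl⟩))
  have hholder : HolderOnWith (2 * (2 : ℝ) ^ s).toNNReal s.toNNReal g (X '' K) := by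
    rintro _ ⟨a, ha, rfl⟩ _ ⟨b, hb, rfl⟩
    rw [hg a ha, hg b hb, edist_dist, edist_dist, Real.dist_eq, Real.dist_eq,
      Real.coe_toNNReal _ hspos.le, ENNReal.ofReal_rpow_of_nonneg (abs_nonneg _) hspos.le]
    change _ ≤ ENNReal.ofReal _ * _
    rw [← ENNReal.ofReal_mul (by positivity)]
    exact ENNReal.ofReal_le_ofReal (abs_ofDigits_sub_le_rpow hq hσ a b)
  have himage : Set.Ico (0 : ℝ) 1 ⊆ g '' (X '' K) := fun y hy ↦
    ⟨_, ⟨Real.digits y 2, exists_digits_two_eq_zero hy, rfl⟩,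
      (hg _ (exists_digits_two_eq_zero hy)).trans (Real.ofDigits_digits one_lt_two hy)⟩
  have hone : dimH (Set.Ico (0 : ℝ) 1) = 1 := by
    rw [Real.dimH_of_nonempty_interior (by simp [interior_Ico])]
    simp
  have hdim : 1 ≤ dimH (X '' K) / ENNReal.ofReal s := by
    rw [← hone]
    exact (dimH_mono himage).trans (hholder.dimH_image_le (Real.toNNReal_pos.2 hspos))
  have hsub : X '' K ⊆ L := by
    rintro _ ⟨a, ha, rfl⟩
    exact hL a ha
  rw [ENNReal.le_div_iff_mul_le (Or.inl (ENNReal.ofReal_pos.2 hspos).ne')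
    (Or.inl ENNReal.ofReal_ne_top), one_mul] at hdim
  exact hdim.trans (dimH_mono hsub)

lemma le_dimH_zero_level {φ : ℤ → ℝ} {σ : Fin 2 → Fin 3} {p q : ℝ} (hq : 1 ≤ q)
    (hσ : ∀ t, ((σ t : ℕ) : ℝ) = p + q * (t : ℕ)) (hσ0 : σ 0 ≠ 2)
    (hφ : ∀ t, φ ((σ t : ℕ) : ℤ) = 0) :
    ENNReal.ofReal (Real.log 2 / Real.log 3) ≤
      dimH {x ∈ Set.Ico (0 : ℝ) 1 | ∑' n : ℕ, φ (terDigit n x) / 3 ^ (n + 1) = 0} := by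
  refine le_dimH_of_ofDigits_comp_mem hq hσ fun a ha ↦ ?_
  have hne : ∀ n, ∃ m, (σ ∘ a) (m + n) ≠ 2 := fun n ↦ by
    obtain ⟨m, hm⟩ := ha n
    exact ⟨m, by rwa [Function.comp_apply, hm]⟩
  obtain ⟨m, hm⟩ := hne 0
  refine ⟨⟨Real.ofDigits_nonneg _, ofDigits_lt_one hm⟩, ?_⟩
  simp [terDigit_ofDigits hne, hφ]

theorem stmt_17 :
    (dimH {x ∈ Set.Ico (0:ℝ) 1 | f01 x = 0} = ENNReal.ofReal (Real.log 2 / Real.log 3) ∧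
     dimH {x ∈ Set.Ico (0:ℝ) 1 | f02 x = 0} = ENNReal.ofReal (Real.log 2 / Real.log 3) ∧
     dimH {x ∈ Set.Ico (0:ℝ) 1 | f12 x = 0} = ENNReal.ofReal (Real.log 2 / Real.log 3)) ∧
    ∀ y ∈ Set.Ico (0:ℝ) 1,
      dimH {x ∈ Set.Ico (0:ℝ) 1 | f01 x = y} ≤ ENNReal.ofReal (Real.log 2 / Real.log 3) := by
  have hne : ∀ {φ : ℤ → ℝ} {d e : ℤ}, d ∈ ({0, 1, 2} : Finset ℤ) → e ∈ ({0, 1, 2} : Finset ℤ) →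
      φ d = 0 → φ e = 1 → ∀ v, ∃ c ∈ ({0, 1, 2} : Finset ℤ), φ c ≠ v := by
    intro φ d e hd he hd0 he1 v
    by_cases hv : v = 0
    · exact ⟨e, he, by rw [he1, hv]; exact one_ne_zero⟩
    · exact ⟨d, hd, by rw [hd0]; exact Ne.symm hv⟩
  have h01 : ∀ y, dimH {x ∈ Set.Ico (0 : ℝ) 1 | f01 x = y} ≤
      ENNReal.ofReal (Real.log 2 / Real.log 3) :=
    dimH_level_le (φ := phi01) (by norm_num [phi01])
      (hne (d := 0) (e := 2) (by simp) (by simp) (by norm_num [phi01]) (by norm_num [phi01]))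
  refine ⟨⟨le_antisymm (h01 0) ?_, le_antisymm ?_ ?_, le_antisymm ?_ ?_⟩, fun y _ ↦ h01 y⟩
  · exact le_dimH_zero_level (φ := phi01) (σ := ![0, 1]) (p := 0) (q := 1) le_rfl
      (by simp [Fin.forall_fin_two]) (by simp) (by simp [Fin.forall_fin_two, phi01])
  · exact dimH_level_le (φ := phi02) (by norm_num [phi02])
      (hne (d := 0) (e := 1) (by simp) (by simp) (by norm_num [phi02]) (by norm_num [phi02])) 0
  · exact le_dimH_zero_level (φ := phi02) (σ := ![0, 2]) (p := 0) (q := 2) one_le_two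
      (by simp [Fin.forall_fin_two]) (by simp) (by norm_num [Fin.forall_fin_two, phi02])
  · exact dimH_level_le (φ := phi12) (by norm_num [phi12])
      (hne (d := 1) (e := 0) (by simp) (by simp) (by norm_num [phi12]) (by norm_num [phi12])) 0
  · exact le_dimH_zero_level (φ := phi12) (σ := ![1, 2]) (p := 1) (q := 1) le_rfl
      (by norm_num [Fin.forall_fin_two]) (by simp) (by norm_num [Fin.forall_fin_two, phi12])
end
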